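/- Let f be Lipschitz continuous on an open neighborhood of the closed ball B̄_ε(x), where x ∈ X and ε > 0, and suppose 0 ∉ ∂^ε f(x). Let ã be the unique element of minimal norm in ∂^ε f(x). Then f(x − ε·ã/‖ã‖) − f(x) ≤ −ε·‖ã‖; in particular, for every δ ∈ (0,1), a := ã satisfies the sufficient-descent condition f(x − ε·a/‖a‖) − f(x) ≤ −δ·ε·‖a‖. -/

import Mathlib

open Filter Metric Set Topology MeasureTheory
open scoped RealInnerProductSpace NNReal

variable {X : Type*} [NormedAddCommGroup X] [InnerProductSpace ℝ X] [CompleteSpace X]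

/-- Clarke's generalized directional derivative. -/
noncomputable def clarkeDeriv (f : X → ℝ) (x h : X) : ℝ :=
  Filter.limsup (fun p : X × ℝ => (f (p.1 + p.2 • h) - f p.1) / p.2)
    ((𝓝 x) ×ˢ (𝓝[>] (0:ℝ)))

/-- Clarke's generalized gradient. -/
noncomputable def clarkeGrad (f : X → ℝ) (x : X) : Set X :=
  {a | ∀ h : X, ⟪a, h⟫ ≤ clarkeDeriv f x h}

/-- The gradient of `f` on the closed ball of radius `ε` about `x`. -/
noncomputable def epsGrad (f : X → ℝ) (ε : ℝ) (x : X) : Set X :=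
  closure (convexHull ℝ (⋃ y ∈ Metric.closedBall x ε, clarkeGrad f y))

/-- The directional derivative of `f` on the closed ball of radius `ε` about `x`. -/
noncomputable def epsDeriv (f : X → ℝ) (ε : ℝ) (x h : X) : ℝ :=
  sSup ((fun y => clarkeDeriv f y h) '' Metric.closedBall x ε)

set_option linter.unusedSectionVars false

section ClarkeCalculus

variable {f : X → ℝ} {U : Set X} {L : ℝ≥0} {y : X}

theorem eventually_abs_diffQuotient_le (hU : U ∈ 𝓝 y) (hf : LipschitzOnWith L f U) (h : X) :
    ∀ᶠ p : X × ℝ in (𝓝 y) ×ˢ (𝓝[>] (0:ℝ)),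
      |(f (p.1 + p.2 • h) - f p.1) / p.2| ≤ L * ‖h‖ := by
  have hfst : Tendsto (fun p : X × ℝ => p.1) ((𝓝 y) ×ˢ (𝓝[>] (0:ℝ))) (𝓝 y) := tendsto_fst
  have hsnd : Tendsto (fun p : X × ℝ => p.2) ((𝓝 y) ×ˢ (𝓝[>] (0:ℝ))) (𝓝[>] 0) := tendsto_snd
  have hadd : Tendsto (fun p : X × ℝ => p.1 + p.2 • h) ((𝓝 y) ×ˢ (𝓝[>] (0:ℝ))) (𝓝 y) := by
    simpa using hfst.add ((hsnd.mono_right nhdsWithin_le_nhds).smul_const h)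
  filter_upwards [hfst.eventually hU, hadd.eventually hU, hsnd.eventually self_mem_nhdsWithin]
    with p h1 h2 h3
  have h3' : 0 < p.2 := h3
  rw [abs_div, abs_of_pos h3', div_le_iff₀ h3']
  have := hf.dist_le_mul _ h2 _ h1
  rw [Real.dist_eq, dist_eq_norm, add_sub_cancel_left, norm_smul, Real.norm_eq_abs,
    abs_of_pos h3'] at this
  linarith

theorem isBoundedUnder_diffQuotient (hU : U ∈ 𝓝 y) (hf : LipschitzOnWith L f U) (h : X) :
    IsBoundedUnder (· ≤ ·) ((𝓝 y) ×ˢ (𝓝[>] (0:ℝ)))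
      (fun p : X × ℝ => (f (p.1 + p.2 • h) - f p.1) / p.2) :=
  isBoundedUnder_of_eventually_le
    ((eventually_abs_diffQuotient_le hU hf h).mono fun _ hp => (abs_le.1 hp).2)

theorem isCoboundedUnder_diffQuotient (hU : U ∈ 𝓝 y) (hf : LipschitzOnWith L f U) (h : X) :
    IsCoboundedUnder (· ≤ ·) ((𝓝 y) ×ˢ (𝓝[>] (0:ℝ)))
      (fun p : X × ℝ => (f (p.1 + p.2 • h) - f p.1) / p.2) :=
  (isBoundedUnder_of_eventually_ge
    ((eventually_abs_diffQuotient_le hU hf h).mono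
      fun _ hp => (abs_le.1 hp).1)).isCoboundedUnder_le

theorem eventually_diffQuotient_lt (hU : U ∈ 𝓝 y) (hf : LipschitzOnWith L f U) {h : X} {r : ℝ}
    (hr : clarkeDeriv f y h < r) :
    ∀ᶠ p : X × ℝ in (𝓝 y) ×ˢ (𝓝[>] (0:ℝ)), (f (p.1 + p.2 • h) - f p.1) / p.2 < r :=
  eventually_lt_of_limsup_lt hr (isBoundedUnder_diffQuotient hU hf h)

theorem clarkeDeriv_le_of_eventually_le (hU : U ∈ 𝓝 y) (hf : LipschitzOnWith L f U) {h : X} {r : ℝ}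
    (hr : ∀ᶠ p : X × ℝ in (𝓝 y) ×ˢ (𝓝[>] (0:ℝ)), (f (p.1 + p.2 • h) - f p.1) / p.2 ≤ r) :
    clarkeDeriv f y h ≤ r :=
  limsup_le_of_le (isCoboundedUnder_diffQuotient hU hf h) hr

theorem clarkeDeriv_le_mul_norm (hU : U ∈ 𝓝 y) (hf : LipschitzOnWith L f U) (h : X) :
    clarkeDeriv f y h ≤ L * ‖h‖ :=
  clarkeDeriv_le_of_eventually_le hU hf
    ((eventually_abs_diffQuotient_le hU hf h).mono fun _ hp => (abs_le.1 hp).2)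

theorem clarkeDeriv_zero (f : X → ℝ) (y : X) : clarkeDeriv f y 0 = 0 := by
  simp [clarkeDeriv]

theorem clarkeDeriv_smul_le (hU : U ∈ 𝓝 y) (hf : LipschitzOnWith L f U) {c : ℝ} (hc : 0 < c)
    (h : X) : clarkeDeriv f y (c • h) ≤ c * clarkeDeriv f y h := by
  refine le_of_forall_gt_imp_ge_of_dense fun r hr => ?_
  have hr' : clarkeDeriv f y h < r / c := by rwa [lt_div_iff₀ hc, mul_comm]
  have hscale : Tendsto (fun t : ℝ => t * c) (𝓝[>] 0) (𝓝[>] 0) := by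
    refine tendsto_nhdsWithin_iff.2 ⟨?_, ?_⟩
    · have hlim : Tendsto (fun t : ℝ => t * c) (𝓝 0) (𝓝 (0 * c)) :=
        (continuous_mul_const c).tendsto 0
      rw [zero_mul] at hlim
      exact hlim.mono_left nhdsWithin_le_nhds
    · filter_upwards [self_mem_nhdsWithin] with t ht
      exact mul_pos ht hc
  have hsnd : Tendsto (fun p : X × ℝ => p.2) ((𝓝 y) ×ˢ (𝓝[>] (0:ℝ))) (𝓝[>] 0) := tendsto_snd
  have hmap : Tendsto (fun p : X × ℝ => (p.1, p.2 * c)) ((𝓝 y) ×ˢ (𝓝[>] (0:ℝ)))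
      ((𝓝 y) ×ˢ (𝓝[>] (0:ℝ))) := tendsto_fst.prodMk (hscale.comp hsnd)
  refine clarkeDeriv_le_of_eventually_le hU hf ?_
  filter_upwards [hmap.eventually (eventually_diffQuotient_lt hU hf hr')] with p hp
  rw [← div_div, div_lt_div_iff_of_pos_right hc, mul_smul] at hp
  exact hp.le

theorem clarkeDeriv_smul (hU : U ∈ 𝓝 y) (hf : LipschitzOnWith L f U) {c : ℝ} (hc : 0 < c)
    (h : X) : clarkeDeriv f y (c • h) = c * clarkeDeriv f y h := by
  refine le_antisymm (clarkeDeriv_smul_le hU hf hc h) ?_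
  have := clarkeDeriv_smul_le hU hf (inv_pos.2 hc) (c • h)
  rwa [inv_smul_smul₀ hc.ne', ← div_eq_inv_mul, le_div_iff₀ hc, mul_comm] at this

theorem clarkeDeriv_add_le (hU : U ∈ 𝓝 y) (hf : LipschitzOnWith L f U) (h k : X) :
    clarkeDeriv f y (h + k) ≤ clarkeDeriv f y h + clarkeDeriv f y k := by
  refine le_of_forall_pos_le_add fun η hη => ?_
  have hfst : Tendsto (fun p : X × ℝ => p.1) ((𝓝 y) ×ˢ (𝓝[>] (0:ℝ))) (𝓝 y) := tendsto_fst
  have hsnd : Tendsto (fun p : X × ℝ => p.2) ((𝓝 y) ×ˢ (𝓝[>] (0:ℝ))) (𝓝[>] 0) := tendsto_snd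
  have hadd : Tendsto (fun p : X × ℝ => p.1 + p.2 • h) ((𝓝 y) ×ˢ (𝓝[>] (0:ℝ))) (𝓝 y) := by
    simpa using hfst.add ((hsnd.mono_right nhdsWithin_le_nhds).smul_const h)
  have hmap : Tendsto (fun p : X × ℝ => (p.1 + p.2 • h, p.2)) ((𝓝 y) ×ˢ (𝓝[>] (0:ℝ)))
      ((𝓝 y) ×ˢ (𝓝[>] (0:ℝ))) := hadd.prodMk hsnd
  refine clarkeDeriv_le_of_eventually_le hU hf ?_
  filter_upwards [eventually_diffQuotient_lt (h := h) hU hf (lt_add_of_pos_right _ (half_pos hη)),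
    hmap.eventually
      (eventually_diffQuotient_lt (h := k) hU hf (lt_add_of_pos_right _ (half_pos hη)))]
    with p hp hq
  have hsplit : (f (p.1 + p.2 • (h + k)) - f p.1) / p.2 =
      (f (p.1 + p.2 • h) - f p.1) / p.2 +
        (f (p.1 + p.2 • h + p.2 • k) - f (p.1 + p.2 • h)) / p.2 := by
    rw [smul_add, ← add_assoc]
    ring
  rw [hsplit]
  linarith

/-- The Clarke directional derivative is attained by an element of the Clarke gradient. -/
theorem exists_mem_clarkeGrad_inner_eq (hU : U ∈ 𝓝 y) (hf : LipschitzOnWith L f U) (d : X) :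
    ∃ b ∈ clarkeGrad f y, ⟪b, d⟫ = clarkeDeriv f y d := by
  have hlin : ∀ c : ℝ, c * clarkeDeriv f y d ≤ clarkeDeriv f y (c • d) := by
    intro c
    rcases lt_trichotomy c 0 with hc | rfl | hc
    · have h1 := clarkeDeriv_add_le hU hf (c • d) ((-c) • d)
      rw [clarkeDeriv_smul hU hf (neg_pos.2 hc), ← add_smul, add_neg_cancel, zero_smul,
        clarkeDeriv_zero] at h1
      linarith
    · simp [clarkeDeriv_zero]
    · exact (clarkeDeriv_smul hU hf hc d).ge
  have hwd : ∀ c : ℝ, c • d = 0 → c • clarkeDeriv f y d = 0 := fun c hc => by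
    rcases smul_eq_zero.1 hc with rfl | rfl
    · exact zero_smul ℝ _
    · rw [clarkeDeriv_zero, smul_zero]
  obtain ⟨g, hg, hgle⟩ := exists_extension_of_le_sublinear
    (LinearPMap.mkSpanSingleton' d (clarkeDeriv f y d) hwd) (clarkeDeriv f y)
    (fun c hc h => clarkeDeriv_smul hU hf hc h) (clarkeDeriv_add_le hU hf) (by
      rintro ⟨v, hv⟩
      obtain ⟨c, rfl⟩ := Submodule.mem_span_singleton.1 hv
      simpa only [LinearPMap.mkSpanSingleton'_apply, RingHom.id_apply, smul_eq_mul]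
        using hlin c)
  have hbound : ∀ v, ‖g v‖ ≤ L * ‖v‖ := fun v => by
    refine abs_le.2 ⟨?_, (hgle v).trans (clarkeDeriv_le_mul_norm hU hf v)⟩
    have := (hgle (-v)).trans (clarkeDeriv_le_mul_norm hU hf (-v))
    rw [map_neg, norm_neg] at this
    linarith
  refine ⟨(InnerProductSpace.toDual ℝ X).symm (g.mkContinuous L hbound), fun h => ?_, ?_⟩
  · simpa using hgle h
  · have := hg ⟨d, Submodule.mem_span_singleton_self d⟩
    simpa using this.trans (LinearPMap.mkSpanSingleton'_apply_self d _ hwd _)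

end ClarkeCalculus

theorem convex_epsGrad (f : X → ℝ) (ε : ℝ) (x : X) : Convex ℝ (epsGrad f ε x) :=
  (convex_convexHull ℝ _).closure

theorem clarkeGrad_subset_epsGrad {f : X → ℝ} {ε : ℝ} {x y : X} (hy : y ∈ closedBall x ε) :
    clarkeGrad f y ⊆ epsGrad f ε x :=
  (subset_biUnion_of_mem (u := fun y => clarkeGrad f y) hy).trans
    ((subset_convexHull ℝ _).trans subset_closure)

theorem Convex.sq_norm_le_inner_of_forall_norm_le {K : Set X} (hK : Convex ℝ K) {a b : X}
    (ha : a ∈ K) (hmin : ∀ c ∈ K, ‖a‖ ≤ ‖c‖) (hb : b ∈ K) : ‖a‖ ^ 2 ≤ ⟪b, a⟫ := by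
  have : Nonempty K := ⟨⟨a, ha⟩⟩
  have hinf : ‖(0 : X) - a‖ = ⨅ w : K, ‖(0 : X) - w‖ := by
    refine le_antisymm (le_ciInf fun w => by simpa using hmin w w.2) ?_
    exact ciInf_le ⟨0, by rintro _ ⟨w, rfl⟩; exact norm_nonneg _⟩ (⟨a, ha⟩ : K)
  have := (norm_eq_iInf_iff_real_inner_le_zero hK ha).1 hinf b hb
  rw [zero_sub, inner_neg_left, inner_sub_right, real_inner_self_eq_norm_sq,
    real_inner_comm] at this
  linarith

/-- A uniform bound on the Clarke derivative along a segment bounds the increment of the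
function. -/
theorem sub_le_mul_of_clarkeDeriv_le {f : X → ℝ} {U : Set X} {L : ℝ≥0} {x d : X} {ε m : ℝ}
    (hε : 0 ≤ ε) (hU : ∀ t ∈ Icc (0:ℝ) ε, U ∈ 𝓝 (x + t • d)) (hf : LipschitzOnWith L f U)
    (hm : ∀ t ∈ Icc (0:ℝ) ε, clarkeDeriv f (x + t • d) d ≤ m) :
    f (x + ε • d) - f x ≤ m * ε := by
  have hcont : ContinuousOn (fun t : ℝ => f (x + t • d)) (Icc 0 ε) :=
    hf.continuousOn.comp (by fun_prop) fun t ht => mem_of_mem_nhds (hU t ht)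
  have key := image_le_of_liminf_slope_right_le_deriv_boundary hcont
    (B := fun t => f x + m * t) (B' := fun _ => m) (by simp) (by fun_prop)
    (fun t _ => by
      simpa using (((hasDerivAt_id t).const_mul m).const_add (f x)).hasDerivWithinAt)
    (fun t ht r hr => by
      have ht' := Ico_subset_Icc_self ht
      have hsub : Tendsto (fun z : ℝ => z - t) (𝓝[>] t) (𝓝[>] 0) := by
        refine tendsto_nhdsWithin_iff.2 ⟨?_, ?_⟩
        · have : Tendsto (fun z : ℝ => z - t) (𝓝 t) (𝓝 (t - t)) :=
            (continuous_sub_right t).tendsto t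
          rw [sub_self] at this
          exact this.mono_left nhdsWithin_le_nhds
        · filter_upwards [self_mem_nhdsWithin] with z hz
          exact sub_pos.2 (mem_Ioi.1 hz)
      have hmap : Tendsto (fun z : ℝ => (x + t • d, z - t)) (𝓝[>] t)
          ((𝓝 (x + t • d)) ×ˢ (𝓝[>] (0:ℝ))) := tendsto_const_nhds.prodMk hsub
      refine (hmap.eventually
        (eventually_diffQuotient_lt (hU t ht') hf ((hm t ht').trans_lt hr))).frequently.mono ?_
      intro z hz
      rw [add_assoc, ← add_smul, add_sub_cancel] at hz
      rwa [slope_def_field])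
  have := key (right_mem_Icc.2 hε)
  linarith

/-- From the proof of Proposition 3.9(1): the norm-minimal element of `∂^ε f(x)`
yields a step satisfying the sufficient-descent condition. -/
theorem minNorm_element_gives_sufficient_descent
    (f : X → ℝ) (x : X) (ε : ℝ) (hε : 0 < ε) (L : ℝ≥0) (U : Set X)
    (hU : IsOpen U) (hBU : Metric.closedBall x ε ⊆ U)
    (hf : LipschitzOnWith L f U)
    (hreg : (0 : X) ∉ epsGrad f ε x)
    (a : X) (ha : a ∈ epsGrad f ε x) (hamin : ∀ b ∈ epsGrad f ε x, ‖a‖ ≤ ‖b‖) :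
    f (x - ε • (‖a‖⁻¹ • a)) - f x ≤ -ε * ‖a‖ ∧
    ∀ δ : ℝ, δ ∈ Set.Ioo (0:ℝ) 1 →
      f (x - ε • (‖a‖⁻¹ • a)) - f x ≤ -δ * ε * ‖a‖ := by
  have ha0 : a ≠ 0 := fun h => hreg (h ▸ ha)
  have hpos : 0 < ‖a‖ := norm_pos_iff.2 ha0
  set d : X := -(‖a‖⁻¹ • a) with hd
  have hmem : ∀ t ∈ Icc (0:ℝ) ε, x + t • d ∈ closedBall x ε := fun t ht => by
    rw [mem_closedBall, dist_eq_norm, add_sub_cancel_left, norm_smul, hd, norm_neg, norm_smul,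
      norm_inv, norm_norm, inv_mul_cancel₀ hpos.ne', mul_one, Real.norm_eq_abs,
      abs_of_nonneg ht.1]
    exact ht.2
  have hnhds : ∀ t ∈ Icc (0:ℝ) ε, U ∈ 𝓝 (x + t • d) := fun t ht =>
    hU.mem_nhds (hBU (hmem t ht))
  have hderiv : ∀ t ∈ Icc (0:ℝ) ε, clarkeDeriv f (x + t • d) d ≤ -‖a‖ := fun t ht => by
    obtain ⟨b, hb, hbd⟩ := exists_mem_clarkeGrad_inner_eq (hnhds t ht) hf d
    have hab := (convex_epsGrad f ε x).sq_norm_le_inner_of_forall_norm_le ha hamin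
      (clarkeGrad_subset_epsGrad (hmem t ht) hb)
    rw [← hbd, hd, inner_neg_right, real_inner_smul_right, neg_le_neg_iff, ← div_eq_inv_mul,
      le_div_iff₀ hpos]
    linarith [sq ‖a‖]
  have hmain : f (x - ε • (‖a‖⁻¹ • a)) - f x ≤ -ε * ‖a‖ := by
    have := sub_le_mul_of_clarkeDeriv_le hε.le hnhds hf hderiv
    rw [hd, smul_neg, ← sub_eq_add_neg] at this
    linarith
  refine ⟨hmain, fun δ hδ => hmain.trans ?_⟩
  nlinarith [mul_pos hε hpos, hδ.2]
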